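/- Let M, N be von Neumann algebras with M having no type I₂ direct summand, and let φ : P(M) → P(N) be a map on projection lattices with φ(0) = 0 such that φ(p + q) = φ(p) + φ(q) and φ(p)φ(q) = 0 whenever p q = 0. Suppose T : M → N is a bounded linear extension of φ. Then T is positive, ‖T‖ = ‖T(1)‖ on positive contractions, and T is a Jordan *-homomorphism (T(x ∘ y) = T(x) ∘ T(y) where x ∘ y = (xy + yx)/2, and T(x*) = T(x)*). -/

import Mathlib

/-- A projection: self-adjoint idempotent. -/
def IsProjection {A : Type*} [Ring A] [StarRing A] (p : A) : Prop :=
  IsIdempotentElem p ∧ IsSelfAdjoint p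

/-- `A` has a type I₂ direct summand: there is a nonzero central projection `z` such that
the corner `z A` is *-isomorphic to an algebra of continuous functions from a compact
Hausdorff space into 2×2 complex matrices (realized here as a surjective star algebra
homomorphism onto `Matrix (Fin 2) (Fin 2) C(X, ℂ)` with kernel `{x | z x = 0}`). -/
def HasTypeI2Summand (A : Type*) [Ring A] [StarRing A] [Algebra ℂ A] : Prop :=
  ∃ z : A, IsProjection z ∧ z ≠ 0 ∧ (∀ x : A, z * x = x * z) ∧
    ∃ (X : Type) (_ : TopologicalSpace X) (_ : CompactSpace X) (_ : T2Space X)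
      (f : A →⋆ₐ[ℂ] Matrix (Fin 2) (Fin 2) C(X, ℂ)),
      Function.Surjective f ∧ ∀ x : A, f x = 0 ↔ z * x = 0

open scoped NNReal

section Operators

variable {H : Type*} [NormedAddCommGroup H] [InnerProductSpace ℂ H] [CompleteSpace H]

/-- The projection onto the kernel of a self-adjoint operator commutes with everything the
operator commutes with. -/
theorem exists_isStarProjection_ker {b : H →L[ℂ] H} (hb : IsSelfAdjoint b) :
    ∃ e : H →L[ℂ] H, IsStarProjection e ∧ b * e = 0 ∧ (∀ c, b * c = 0 → e * c = c) ∧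
      ∀ z, Commute b z → Commute e z := by
  have hclosed : IsClosed (b.ker : Set H) := b.isClosed_ker
  have : CompleteSpace b.ker := hclosed.completeSpace_coe
  have hbe : b * b.ker.starProjection = 0 := by
    ext v
    exact Submodule.starProjection_apply_mem b.ker v
  have hfix : ∀ c, b * c = 0 → b.ker.starProjection * c = c := by
    intro c hc
    ext v
    exact Submodule.starProjection_eq_self_iff.2 (DFunLike.congr_fun hc v)
  have hproj : IsStarProjection b.ker.starProjection := isStarProjection_starProjection
  refine ⟨b.ker.starProjection, hproj, hbe, hfix, fun z hz => ?_⟩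
  generalize b.ker.starProjection = e at *
  have key : ∀ w, Commute b w → e * (w * e) = w * e := fun w hw =>
    hfix _ (by rw [← mul_assoc, hw.eq, mul_assoc, hbe, mul_zero])
  have h1 := key z hz
  have h2 := congrArg star (key (star z) (by simpa [hb.star_eq] using hz.star_star))
  simp only [star_mul, star_star, hproj.isSelfAdjoint.star_eq, mul_assoc] at h2
  exact h2.symm.trans h1

/-- The spectral projection of a positive contraction for the interval `(1/2, 1]`. -/
theorem exists_isStarProjection_two_nsmul_sub {x : H →L[ℂ] H} (h0 : 0 ≤ x) (h1 : x ≤ 1) :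
    ∃ p : H →L[ℂ] H, IsStarProjection p ∧ (∀ z, Commute x z → Commute p z) ∧
      0 ≤ x + x - p ∧ x + x - p ≤ 1 := by
  have hx : IsSelfAdjoint x := IsSelfAdjoint.of_nonneg h0
  set a : H →L[ℂ] H := x + x - 1 with ha
  have hasa : IsSelfAdjoint a := (hx.add hx).sub (.one _)
  have hsub : a⁺ - a⁻ = a := CFC.posPart_sub_negPart a
  obtain ⟨e, he, hbe, hfix, hcomm⟩ :=
    exists_isStarProjection_ker (IsSelfAdjoint.of_nonneg (CFC.posPart_nonneg a))
  have hcx : ∀ z, Commute x z → Commute e z := fun z hz => by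
    refine hcomm z ?_
    rw [CFC.posPart_def]
    exact Commute.cfcₙ_real (((hz.add_left hz).sub_left (Commute.one_left z))) _
  have hee : e * e = e := he.isIdempotentElem.eq
  have hxe : x * e = e * x := (hcx x (.refl x)).eq.symm
  have hneg : a⁻ * e = a⁻ := by
    have := congrArg star (hfix a⁻ (CFC.posPart_mul_negPart a))
    rwa [star_mul, he.isSelfAdjoint.star_eq,
      (IsSelfAdjoint.of_nonneg (CFC.negPart_nonneg a)).star_eq] at this
  have hae : a * e = -a⁻ := by
    calc a * e = a⁺ * e - a⁻ * e := by rw [← sub_mul, hsub]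
      _ = -a⁻ := by rw [hbe, hneg, zero_sub]
  have hexe : e * x * e = x * e := by rw [← hxe, mul_assoc, hee]
  have hae' : x * e + x * e - e = -a⁻ := by rw [← hae, ha, sub_mul, add_mul, one_mul]
  refine ⟨1 - e, he.one_sub, fun z hz => (Commute.one_left z).sub_left (hcx z hz), ?_, ?_⟩
  · have h2 : 0 ≤ e * x * e := he.isSelfAdjoint.conjugate_nonneg h0
    have : x + x - (1 - e) = (e * x * e + e * x * e) + a⁺ := by
      have h3 : a⁺ = a + a⁻ := sub_eq_iff_eq_add.1 hsub
      rw [h3, hexe, ← neg_eq_iff_eq_neg.2 hae', ha]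
      abel
    rw [this]
    exact add_nonneg (add_nonneg h2 h2) (CFC.posPart_nonneg a)
  · have h2 : 0 ≤ (1 - e) * (1 - x) * (1 - e) :=
      he.one_sub.isSelfAdjoint.conjugate_nonneg (sub_nonneg.2 h1)
    have h3 : (1 - e) * (1 - x) * (1 - e) = 1 - e - x + x * e := by
      simp only [sub_mul, mul_sub, one_mul, mul_one, hee, hexe]
      rw [← hxe]
      abel
    have : 1 - (x + x - (1 - e)) =
        ((1 - e) * (1 - x) * (1 - e) + (1 - e) * (1 - x) * (1 - e)) + a⁻ := by
      rw [h3, ← neg_eq_iff_eq_neg.2 hae']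
      abel
    rw [← sub_nonneg, this]
    exact add_nonneg (add_nonneg h2 h2) (CFC.negPart_nonneg a)

end Operators

/-- The projections that commute with everything `x` commutes with. -/
def bicommutantProjections {A : Type*} [Ring A] [StarRing A] (x : A) : Set A :=
  {p | IsProjection p ∧ ∀ z, Commute x z → Commute p z}

theorem commute_of_mem_bicommutantProjections {A : Type*} [Ring A] [StarRing A]
    {x p q : A}
    (hp : p ∈ bicommutantProjections x) (hq : q ∈ bicommutantProjections x) : Commute p q :=
  hp.2 q (hq.2 x (.refl x)).symm

section VonNeumann

variable {H : Type*} [NormedAddCommGroup H] [InnerProductSpace ℂ H] [CompleteSpace H]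
  {M : VonNeumannAlgebra H}

theorem exists_mem_bicommutantProjections {x : M.toStarSubalgebra} (h0 : 0 ≤ x) (h1 : x ≤ 1) :
    ∃ p ∈ bicommutantProjections x, 0 ≤ x + x - p ∧ x + x - p ≤ 1 := by
  obtain ⟨p, hp, hc, hp0, hp1⟩ :=
    exists_isStarProjection_two_nsmul_sub (x := (x : H →L[ℂ] H)) h0 h1
  have hmem : p ∈ M.toStarSubalgebra := by
    change p ∈ (M : Set (H →L[ℂ] H))
    rw [← M.centralizer_centralizer]
    exact fun z hz => ((hc z (hz x x.2)).eq).symm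
  exact ⟨⟨p, hmem⟩, ⟨⟨Subtype.ext hp.isIdempotentElem, Subtype.ext hp.isSelfAdjoint⟩,
    fun z hz => Subtype.ext (hc z (congrArg Subtype.val hz))⟩, hp0, hp1⟩

/-- Every positive contraction is a norm limit of nonnegative combinations of projections from
its bicommutant. -/
theorem mem_closure_span_bicommutantProjections {x : M.toStarSubalgebra}
    (h0 : 0 ≤ x) (h1 : x ≤ 1) :
    x ∈ closure (Submodule.span ℝ≥0 (bicommutantProjections x) : Set M.toStarSubalgebra) := by
  have key : ∀ (n : ℕ) (x : M.toStarSubalgebra), 0 ≤ x → x ≤ 1 →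
      ∃ y ∈ Submodule.span ℝ≥0 (bicommutantProjections x), ‖x - y‖ ≤ (1 / 2) ^ n := by
    intro n
    induction n with
    | zero =>
      intro x h0 h1
      refine ⟨0, Submodule.zero_mem _, ?_⟩
      rw [sub_zero, pow_zero]
      exact (CStarAlgebra.norm_le_one_iff_of_nonneg (x : H →L[ℂ] H) h0).2 h1
    | succ n ih =>
      intro x h0 h1
      obtain ⟨p, hp, hp0, hp1⟩ := exists_mem_bicommutantProjections h0 h1
      obtain ⟨y, hy, hxy⟩ := ih _ hp0 hp1
      have hsub : bicommutantProjections (x + x - p) ⊆ bicommutantProjections x :=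
        fun q hq => ⟨hq.1, fun z hz => hq.2 z ((hz.add_left hz).sub_left (hp.2 z hz))⟩
      refine ⟨(1 / 2 : ℝ≥0) • (p + y), Submodule.smul_mem _ _
        (Submodule.add_mem _ (Submodule.subset_span hp) (Submodule.span_mono hsub hy)), ?_⟩
      have : x - (1 / 2 : ℝ≥0) • (p + y) = (1 / 2 : ℝ) • (x + x - p - y) := by
        rw [NNReal.smul_def]
        push_cast
        module
      rw [this, norm_smul, pow_succ']
      norm_num at hxy ⊢
      exact hxy
  refine Metric.mem_closure_iff.2 fun ε hε => ?_
  obtain ⟨n, hn⟩ := exists_pow_lt_of_lt_one hε (by norm_num : (1 / 2 : ℝ) < 1)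
  obtain ⟨y, hy, hxy⟩ := key n x h0 h1
  exact ⟨y, hy, by rw [dist_eq_norm]; exact hxy.trans_lt hn⟩

theorem le_one_of_norm_le_one {x : M.toStarSubalgebra} (h0 : 0 ≤ x) (h1 : ‖x‖ ≤ 1) : x ≤ 1 :=
  (CStarAlgebra.norm_le_one_iff_of_nonneg (x : H →L[ℂ] H) h0).1 h1

theorem exists_smul_of_nonneg {x : M.toStarSubalgebra} (h0 : 0 ≤ x) :
    ∃ (r : ℝ≥0) (w : M.toStarSubalgebra), 0 ≤ w ∧ w ≤ 1 ∧ x = (r : ℂ) • w := by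
  have hr : (0 : ℝ) < ‖x‖ + 1 := by positivity
  have hw : 0 ≤ ((‖x‖ + 1)⁻¹ : ℝ) • x :=
    smul_nonneg (α := ℝ) (β := H →L[ℂ] H) (inv_nonneg.2 hr.le) h0
  refine ⟨⟨‖x‖ + 1, hr.le⟩, ((‖x‖ + 1)⁻¹ : ℝ) • x, hw, le_one_of_norm_le_one hw ?_, ?_⟩
  · rw [norm_smul, norm_inv, Real.norm_of_nonneg hr.le, inv_mul_le_one₀ hr]
    linarith
  · change x = ((‖x‖ + 1 : ℝ) : ℂ) • _
    rw [Complex.coe_smul, smul_smul, mul_inv_cancel₀ hr.ne', one_smul]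

theorem span_nonneg_eq_top :
    Submodule.span ℂ {x : M.toStarSubalgebra | 0 ≤ x} = ⊤ := by
  have hsa : ∀ x : M.toStarSubalgebra, IsSelfAdjoint x →
      x ∈ Submodule.span ℂ {x : M.toStarSubalgebra | 0 ≤ x} := by
    intro x hx
    have hx' : IsSelfAdjoint (x : H →L[ℂ] H) := congrArg Subtype.val hx
    have h1 : 0 ≤ x + algebraMap ℝ M.toStarSubalgebra ‖x‖ := by
      change 0 ≤ (x : H →L[ℂ] H) + algebraMap ℝ (H →L[ℂ] H) ‖(x : H →L[ℂ] H)‖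
      exact neg_le_iff_add_nonneg.1 hx'.neg_algebraMap_norm_le_self
    have h2 : 0 ≤ algebraMap ℝ M.toStarSubalgebra ‖x‖ := by
      change 0 ≤ algebraMap ℝ (H →L[ℂ] H) ‖(x : H →L[ℂ] H)‖
      exact algebraMap_nonneg _ (norm_nonneg _)
    rw [← add_sub_cancel_right x (algebraMap ℝ M.toStarSubalgebra ‖x‖)]
    exact Submodule.sub_mem _ (Submodule.subset_span h1) (Submodule.subset_span h2)
  refine eq_top_iff.2 fun x _ => ?_
  rw [← realPart_add_I_smul_imaginaryPart x]
  exact Submodule.add_mem _ (hsa _ (realPart x).2)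
    (Submodule.smul_mem _ _ (hsa _ (imaginaryPart x).2))

end VonNeumann

section OrthogonallyMultiplicative

variable {A B : Type*} [Ring A] [StarRing A] [Algebra ℂ A] [Ring B] [StarRing B] [Algebra ℂ B]

/-- A linear map that preserves projections and their orthogonality is multiplicative on
commuting projections. -/
theorem map_mul_of_commute_projections (T : A →ₗ[ℂ] B)
    (hproj : ∀ p, IsProjection p → IsProjection (T p))
    (horth : ∀ p q, IsProjection p → IsProjection q → p * q = 0 → T p * T q = 0)
    {p q : A} (hp : IsProjection p) (hq : IsProjection q) (hpq : Commute p q) :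
    T (p * q) = T p * T q := by
  have mk : ∀ {a b : A}, IsProjection a → IsProjection b → Commute a b →
      IsProjection (a * b) := fun ha hb hab => ⟨ha.1.mul_of_commute hab hb.1,
    (IsSelfAdjoint.commute_iff ha.2 hb.2).1 hab⟩
  have compl : ∀ {a : A}, IsProjection a → IsProjection (1 - a) := fun ha =>
    ⟨ha.1.one_sub, (IsSelfAdjoint.one A).sub ha.2⟩
  have hq0 : q * (1 - q) = 0 := by rw [mul_sub, mul_one, hq.1.eq, sub_self]
  have hq0' : (1 - q) * q = 0 := by rw [sub_mul, one_mul, hq.1.eq, sub_self]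
  have hp0 : p * (1 - p) = 0 := by rw [mul_sub, mul_one, hp.1.eq, sub_self]
  have hc1 : Commute p (1 - q) := (Commute.one_right p).sub_right hpq
  have hc2 : Commute (1 - p) q := (Commute.one_left q).sub_left hpq
  have hr := mk hp hq hpq
  have hs := mk hp (compl hq) hc1
  have ht := mk (compl hp) hq hc2
  have hTr : T (p * q) * T (p * q) = T (p * q) := (hproj _ hr).1.eq
  have hrt : T (p * q) * T ((1 - p) * q) = 0 := horth _ _ hr ht (by
    rw [hpq.eq, mul_assoc, ← mul_assoc p, hp0, zero_mul, mul_zero])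
  have hsr : T (p * (1 - q)) * T (p * q) = 0 := horth _ _ hs hr (by
    rw [hpq.eq, mul_assoc, ← mul_assoc _ q, hq0', zero_mul, mul_zero])
  have hst : T (p * (1 - q)) * T ((1 - p) * q) = 0 := horth _ _ hs ht (by
    rw [hc2.eq, mul_assoc, ← mul_assoc _ q, hq0', zero_mul, mul_zero])
  have hp' : T p = T (p * q) + T (p * (1 - q)) := by rw [← map_add, ← mul_add]; simp
  have hq' : T q = T (p * q) + T ((1 - p) * q) := by rw [← map_add, ← add_mul]; simp
  rw [hp', hq', add_mul, mul_add, mul_add, hTr, hrt, hsr, hst]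
  simp

theorem map_mul_of_mem_span_bicommutantProjections (T : A →ₗ[ℂ] B)
    (hproj : ∀ p, IsProjection p → IsProjection (T p))
    (horth : ∀ p q, IsProjection p → IsProjection q → p * q = 0 → T p * T q = 0)
    {x y z : A} (hy : y ∈ Submodule.span ℝ≥0 (bicommutantProjections x))
    (hz : z ∈ Submodule.span ℝ≥0 (bicommutantProjections x)) :
    T (y * z) = T y * T z := by
  have hsmul : ∀ (r : ℝ≥0) (a : A), T (r • a) = r • T a := fun r a => map_smul T (r : ℂ) a
  induction hy, hz using Submodule.span_induction₂ with
  | mem_mem p q hp hq =>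
    exact map_mul_of_commute_projections T hproj horth hp.1 hq.1
      (commute_of_mem_bicommutantProjections hp hq)
  | zero_left | zero_right => simp
  | add_left a b c _ _ _ h1 h2 => rw [add_mul, map_add, map_add, add_mul, h1, h2]
  | add_right a b c _ _ _ h1 h2 => rw [mul_add, map_add, map_add, mul_add, h1, h2]
  | smul_left r a b _ _ h => rw [smul_mul_assoc, hsmul, hsmul, smul_mul_assoc, h]
  | smul_right r a b _ _ h => rw [mul_smul_comm, hsmul, hsmul, mul_smul_comm, h]

/-- A linear map that preserves squares on an additively closed set is a Jordan homomorphism on its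
span. -/
theorem map_mul_add_mul_of_mem_span {A B : Type*} [Ring A] [Algebra ℂ A] [Ring B] [Algebra ℂ B]
    (T : A →ₗ[ℂ] B) {S : Set A}
    (hadd : ∀ a ∈ S, ∀ b ∈ S, a + b ∈ S) (hsq : ∀ a ∈ S, T (a * a) = T a * T a) {x y : A}
    (hx : x ∈ Submodule.span ℂ S) (hy : y ∈ Submodule.span ℂ S) :
    T (x * y + y * x) = T x * T y + T y * T x := by
  induction hx, hy using Submodule.span_induction₂ with
  | mem_mem a b ha hb =>
    have h := hsq _ (hadd a ha b hb)
    simp only [add_mul, mul_add, map_add, hsq a ha, hsq b hb] at h ⊢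
    have h' := congrArg (fun t => t - T a * T a - T b * T b) h
    convert h' using 1 <;> abel
  | zero_left | zero_right => simp
  | add_left a b c _ _ _ h1 h2 =>
    rw [show (a + b) * c + c * (a + b) = (a * c + c * a) + (b * c + c * b) by noncomm_ring,
      map_add, h1, h2, map_add]
    noncomm_ring
  | add_right a b c _ _ _ h1 h2 =>
    rw [show a * (b + c) + (b + c) * a = (a * b + b * a) + (a * c + c * a) by noncomm_ring,
      map_add, h1, h2, map_add]
    noncomm_ring
  | smul_left r a b _ _ h | smul_right r a b _ _ h =>
    simp only [smul_mul_assoc, mul_smul_comm, ← smul_add, map_smul, h]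

end OrthogonallyMultiplicative

section Bounded

variable {H K : Type*} [NormedAddCommGroup H] [InnerProductSpace ℂ H] [CompleteSpace H]
  [NormedAddCommGroup K] [InnerProductSpace ℂ K] [CompleteSpace K]
  {M : VonNeumannAlgebra H} {N : VonNeumannAlgebra K}

theorem map_nonneg_of_map_isProjection (T : M.toStarSubalgebra →L[ℂ] N.toStarSubalgebra)
    (hproj : ∀ p, IsProjection p → IsProjection (T p)) {x : M.toStarSubalgebra} (hx : 0 ≤ x) :
    0 ≤ T x := by
  obtain ⟨r, w, h0, h1, rfl⟩ := exists_smul_of_nonneg hx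
  have hclosed : IsClosed {y : M.toStarSubalgebra | 0 ≤ (T y : K →L[ℂ] K)} :=
    isClosed_le continuous_const (continuous_subtype_val.comp T.continuous)
  have hsmul : ∀ (r : ℝ≥0) (y : M.toStarSubalgebra), 0 ≤ (T y : K →L[ℂ] K) →
      0 ≤ (T ((r : ℂ) • y) : K →L[ℂ] K) := by
    intro r y hy
    rw [map_smul]
    exact smul_nonneg (α := ℝ) (β := K →L[ℂ] K) r.2 hy
  refine hsmul r w (closure_minimal (fun y hy => ?_) hclosed
    (mem_closure_span_bicommutantProjections h0 h1))
  induction hy using Submodule.span_induction with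
  | mem p hp =>
    have hp' := hproj p hp.1
    exact IsStarProjection.nonneg (p := (T p : K →L[ℂ] K))
      ⟨congrArg Subtype.val hp'.1, congrArg Subtype.val hp'.2⟩
  | zero => simp
  | add a b _ _ ha hb =>
    change 0 ≤ (T (a + b) : K →L[ℂ] K)
    rw [map_add]
    exact add_nonneg (α := K →L[ℂ] K) ha hb
  | smul r a _ ha => exact hsmul r a ha

theorem map_mul_self_of_nonneg (T : M.toStarSubalgebra →L[ℂ] N.toStarSubalgebra)
    (hproj : ∀ p, IsProjection p → IsProjection (T p))
    (horth : ∀ p q, IsProjection p → IsProjection q → p * q = 0 → T p * T q = 0)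
    {x : M.toStarSubalgebra} (hx : 0 ≤ x) : T (x * x) = T x * T x := by
  obtain ⟨r, w, h0, h1, rfl⟩ := exists_smul_of_nonneg hx
  have hclosed : IsClosed {y : M.toStarSubalgebra | T (y * y) = T y * T y} :=
    isClosed_eq (by fun_prop) (by fun_prop)
  have hw : T (w * w) = T w * T w := closure_minimal
    (fun y hy => show T (y * y) = T y * T y from
      map_mul_of_mem_span_bicommutantProjections
        (T : M.toStarSubalgebra →ₗ[ℂ] N.toStarSubalgebra) hproj horth hy hy)
    hclosed (mem_closure_span_bicommutantProjections h0 h1)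
  simp only [smul_mul_smul_comm, map_smul, hw]

end Bounded

/-- Let `M, N` be von Neumann algebras with `M` having no type I₂ direct summand, and
`φ` a map on projections with `φ 0 = 0`, additive on orthogonal projections and sending
orthogonal projections to orthogonal projections. If `T : M → N` is a bounded linear
extension of `φ`, then `T` is positive, `‖T x‖ ≤ ‖T 1‖` on positive contractions,
and `T` is a Jordan *-homomorphism. -/
theorem bounded_linear_extension_is_jordan_star_hom
    {H K : Type*} [NormedAddCommGroup H] [InnerProductSpace ℂ H] [CompleteSpace H]
    [NormedAddCommGroup K] [InnerProductSpace ℂ K] [CompleteSpace K]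
    (M : VonNeumannAlgebra H) (N : VonNeumannAlgebra K)
    (hM : ¬ HasTypeI2Summand M.toStarSubalgebra)
    (φ : M.toStarSubalgebra → N.toStarSubalgebra)
    (hφ0 : φ 0 = 0)
    (hφproj : ∀ p : M.toStarSubalgebra, IsProjection p → IsProjection (φ p))
    (hφadd : ∀ p q : M.toStarSubalgebra, IsProjection p → IsProjection q → p * q = 0 →
      φ (p + q) = φ p + φ q)
    (hφorth : ∀ p q : M.toStarSubalgebra, IsProjection p → IsProjection q → p * q = 0 →
      φ p * φ q = 0)
    (T : M.toStarSubalgebra →L[ℂ] N.toStarSubalgebra)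
    (hT : ∀ p : M.toStarSubalgebra, IsProjection p → T p = φ p) :
    (∀ x : M.toStarSubalgebra, 0 ≤ x → 0 ≤ T x) ∧
    (∀ x : M.toStarSubalgebra, 0 ≤ x → ‖x‖ ≤ 1 → ‖T x‖ ≤ ‖T 1‖) ∧
    (∀ x y : M.toStarSubalgebra, T (x * y + y * x) = T x * T y + T y * T x) ∧
    (∀ x : M.toStarSubalgebra, T (star x) = star (T x)) := by
  have hproj : ∀ p, IsProjection p → IsProjection (T p) := fun p hp => by
    rw [hT p hp]
    exact hφproj p hp
  have horth : ∀ p q, IsProjection p → IsProjection q → p * q = 0 → T p * T q = 0 :=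
    fun p q hp hq hpq => by
      rw [hT p hp, hT q hq]
      exact hφorth p q hp hq hpq
  have hpos : ∀ x : M.toStarSubalgebra, 0 ≤ x → 0 ≤ T x := fun _ =>
    map_nonneg_of_map_isProjection T hproj
  have hmem : ∀ x : M.toStarSubalgebra, x ∈ Submodule.span ℂ {x : M.toStarSubalgebra | 0 ≤ x} :=
    fun x => span_nonneg_eq_top (M := M) ▸ Submodule.mem_top
  refine ⟨hpos, fun x h0 h1 => ?_, fun x y => ?_, fun x => ?_⟩
  · have hle : (0 : K →L[ℂ] K) ≤ (T (1 - x) : K →L[ℂ] K) :=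
      hpos _ (sub_nonneg.2 (show (x : H →L[ℂ] H) ≤ 1 from le_one_of_norm_le_one h0 h1))
    rw [map_sub] at hle
    exact CStarAlgebra.norm_le_norm_of_nonneg_of_le (a := (T x : K →L[ℂ] K)) (hpos x h0)
      (sub_nonneg.1 hle)
  · exact map_mul_add_mul_of_mem_span (T : M.toStarSubalgebra →ₗ[ℂ] N.toStarSubalgebra)
      (fun a ha b hb => add_nonneg (α := H →L[ℂ] H) ha hb)
      (fun a ha => map_mul_self_of_nonneg T hproj horth ha) (hmem x) (hmem y)
  · induction hmem x using Submodule.span_induction with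
    | mem a ha =>
      have h1 : star a = a := Subtype.ext (IsSelfAdjoint.of_nonneg (R := H →L[ℂ] H) ha)
      have h2 : star (T a) = T a :=
        Subtype.ext (IsSelfAdjoint.of_nonneg (R := K →L[ℂ] K) (hpos a ha))
      rw [h1, h2]
    | zero => simp
    | add a b _ _ ha hb => rw [star_add, map_add, map_add, star_add, ha, hb]
    | smul r a _ h => rw [star_smul, map_smul, map_smul, star_smul, h]
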